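/- arXiv:2010.16054 — 4 statements merged into one kernel-verified Lean document; each statement's English description precedes it below -/
import Mathlib

section
/- Let J be an admissible ideal on ℕ and let Fin be the ideal of finite subsets of ℕ. An infinite real matrix A = (a_{n,k}) is (Fin, J)-regular if and only if A satisfies: (T1) sup_n ∑_k |a_{n,k}| < ∞; (T2) J-lim_n ∑_k a_{n,k} = 1; and (T3) J-lim_n ∑_{k∈E} |a_{n,k}| = 0 for every finite set E ⊆ ℕ. -/
open Filter Topology

/-- `x ∈ ℓ∞`: `x` is a bounded real sequence. -/
def Bdd (x : ℕ → ℝ) : Prop := ∃ C : ℝ, ∀ n, |x n| ≤ C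

/-- An admissible ideal on `ℕ`: a family of subsets of `ℕ` closed under taking
subsets and finite unions, containing every finite set, and not containing `ℕ`. -/
def IsAdmissibleIdeal (I : Set (Set ℕ)) : Prop :=
  (∀ A ∈ I, ∀ B ⊆ A, B ∈ I) ∧
  (∀ A ∈ I, ∀ B ∈ I, A ∪ B ∈ I) ∧
  (∀ A : Set ℕ, A.Finite → A ∈ I) ∧
  (Set.univ : Set ℕ) ∉ I

/-- `I`-convergence of the sequence `x` to `η`. -/
def IdealLim (I : Set (Set ℕ)) (x : ℕ → ℝ) (η : ℝ) : Prop :=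
  ∀ ε : ℝ, 0 < ε → {n : ℕ | ε < |x n - η|} ∈ I

/-- `(Ax)ₙ = ∑ₖ a n k * x k`. -/
noncomputable def matMul (a : ℕ → ℕ → ℝ) (x : ℕ → ℝ) : ℕ → ℝ :=
  fun n => ∑' k, a n k * x k

/-- Condition (T1): `sup_n ∑ₖ |a n k| < ∞`. -/
def CondT1 (a : ℕ → ℕ → ℝ) : Prop :=
  ∃ C : ℝ, ∀ n : ℕ, ∀ F : Finset ℕ, ∑ k ∈ F, |a n k| ≤ C

/-- Condition (T2): the rows of `a` are summable and `J-lim_n ∑ₖ a n k = 1`. -/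
def CondT2 (J : Set (Set ℕ)) (a : ℕ → ℕ → ℝ) : Prop :=
  (∀ n, Summable (a n)) ∧ IdealLim J (fun n => ∑' k, a n k) 1

/-- Condition (T3): `J-lim_n ∑_{k ∈ E} |a n k| = 0` for every `E ∈ I`. -/
def CondT3 (I J : Set (Set ℕ)) (a : ℕ → ℕ → ℝ) : Prop :=
  ∀ E ∈ I, IdealLim J (fun n => ∑' k, E.indicator (fun j => |a n j|) k) 0

/-- `A` is `(I, J)`-regular: `A` maps every bounded `I`-convergent sequence to a
(well-defined) bounded `J`-convergent sequence and preserves the ideal limits. -/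
def IJRegular (I J : Set (Set ℕ)) (a : ℕ → ℕ → ℝ) : Prop :=
  ∀ x : ℕ → ℝ, Bdd x → ∀ η : ℝ, IdealLim I x η →
    (∀ n, Summable fun k => a n k * x k) ∧ Bdd (matMul a x) ∧
      IdealLim J (matMul a x) η

/-- The ideal `Z` of sets of asymptotic density zero. -/
def densityZeroIdeal : Set (Set ℕ) :=
  {S : Set ℕ | Tendsto
    (fun n : ℕ => (∑ k ∈ Finset.Icc 1 n, S.indicator (fun _ => (1 : ℝ)) k) / n)
    atTop (𝓝 0)}

open scoped ZeroAtInfty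

theorem IdealLim.of_abs_le {J : Set (Set ℕ)} (hJ : IsAdmissibleIdeal J) {x y z : ℕ → ℝ}
    {s t u : ℝ} (hy : IdealLim J y s) (hz : IdealLim J z t)
    (h : ∀ ε > 0, ∃ δ > 0, ∀ n, |y n - s| ≤ δ → |z n - t| ≤ δ → |x n - u| ≤ ε) :
    IdealLim J x u := by
  intro ε hε
  obtain ⟨δ, hδ, H⟩ := h ε hε
  refine hJ.1 _ (hJ.2.1 _ (hy δ hδ) _ (hz δ hδ)) _ fun n hn => ?_
  by_contra hc
  simp only [Set.mem_union, Set.mem_ofPred_eq, not_or, not_lt] at hc hn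
  exact absurd (H n hc.1 hc.2) (not_le.mpr hn)

theorem idealLim_const {J : Set (Set ℕ)} (hJ : IsAdmissibleIdeal J) (c : ℝ) :
    IdealLim J (fun _ => c) c := by
  intro ε hε
  have : {n : ℕ | ε < |c - c|} = ∅ := by
    ext n
    simp [hε.le]
  exact hJ.2.2.1 _ (this ▸ Set.finite_empty)

theorem idealLim_sum_abs {J : Set (Set ℕ)} (hJ : IsAdmissibleIdeal J) {a : ℕ → ℕ → ℝ}
    (h : ∀ k, IdealLim J (fun n => a n k) 0) (F : Finset ℕ) :
    IdealLim J (fun n => ∑ k ∈ F, |a n k|) 0 := by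
  induction F using Finset.induction_on with
  | empty => simpa using idealLim_const hJ 0
  | insert k F hk ih =>
    refine (h k).of_abs_le hJ ih fun ε hε => ⟨ε / 2, by positivity, fun n h1 h2 => ?_⟩
    rw [Finset.sum_insert hk]
    rw [sub_zero] at *
    have := abs_add_le |a n k| (∑ i ∈ F, |a n i|)
    rw [abs_abs] at this
    linarith

theorem idealLim_finite_iff {x : ℕ → ℝ} {η : ℝ} :
    IdealLim {E : Set ℕ | E.Finite} x η ↔ Tendsto x cofinite (𝓝 η) := by
  constructor
  · intro h
    refine Metric.tendsto_nhds.mpr fun ε hε => ?_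
    refine (h (ε / 2) (by positivity)).subset fun n hn => ?_
    simp only [Set.mem_compl_iff, Set.mem_ofPred_eq, Real.dist_eq, not_lt] at hn ⊢
    linarith
  · intro h ε hε
    refine (Metric.tendsto_nhds.mp h ε hε).subset fun n hn => ?_
    simp only [Set.mem_compl_iff, Set.mem_ofPred_eq, Real.dist_eq, not_lt] at hn ⊢
    exact hn.le

theorem tsum_indicator_eq_sum {E : Set ℕ} (hE : E.Finite) (f : ℕ → ℝ) :
    ∑' k, E.indicator f k = ∑ k ∈ hE.toFinset, f k := by
  rw [tsum_eq_sum (s := hE.toFinset) fun k hk => Set.indicator_of_notMem (by simpa using hk) f]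
  exact Finset.sum_congr rfl fun k hk => Set.indicator_of_mem (by simpa using hk) f

theorem ZeroAtInftyContinuousMap.abs_apply_le_norm (x : C₀(ℕ, ℝ)) (k : ℕ) : |x k| ≤ ‖x‖ :=
  x.toBCF.norm_coe_le_norm k

theorem Summable.mul_of_abs_le {r x : ℕ → ℝ} (hr : Summable r) {M : ℝ} (hx : ∀ k, |x k| ≤ M) :
    Summable fun k => r k * x k := by
  refine Summable.of_norm_bounded (hr.abs.mul_right M) fun k => ?_
  rw [Real.norm_eq_abs, abs_mul]
  exact mul_le_mul_of_nonneg_left (hx k) (abs_nonneg _)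

theorem abs_tsum_mul_le {r x : ℕ → ℝ} (hr : Summable r) {M : ℝ} (hx : ∀ k, |x k| ≤ M) :
    |∑' k, r k * x k| ≤ (∑' k, |r k|) * M := by
  rw [← tsum_mul_right, ← Real.norm_eq_abs]
  refine tsum_of_norm_bounded (hr.abs.mul_right M).hasSum fun k => ?_
  rw [Real.norm_eq_abs, abs_mul]
  exact mul_le_mul_of_nonneg_left (hx k) (abs_nonneg _)

/-- The functional on `c₀` given by pairing with an absolutely summable sequence. -/
noncomputable def c0Functional (r : ℕ → ℝ) (hr : Summable r) : C₀(ℕ, ℝ) →L[ℝ] ℝ :=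
  LinearMap.mkContinuous
    { toFun := fun x => ∑' k, r k * x k
      map_add' := fun x y => by
        simp only [ZeroAtInftyContinuousMap.add_apply, mul_add]
        exact (hr.mul_of_abs_le x.abs_apply_le_norm).tsum_add
          (hr.mul_of_abs_le y.abs_apply_le_norm)
      map_smul' := fun c x => by
        simp only [ZeroAtInftyContinuousMap.smul_apply, smul_eq_mul, mul_left_comm _ c,
          tsum_mul_left, RingHom.id_apply] }
    (∑' k, |r k|) fun x => abs_tsum_mul_le hr x.abs_apply_le_norm

theorem c0Functional_apply (r : ℕ → ℝ) (hr : Summable r) (x : C₀(ℕ, ℝ)) :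
    c0Functional r hr x = ∑' k, r k * x k := rfl

theorem sum_abs_le_norm_c0Functional (r : ℕ → ℝ) (hr : Summable r) (F : Finset ℕ) :
    ∑ k ∈ F, |r k| ≤ ‖c0Functional r hr‖ := by
  let x : C₀(ℕ, ℝ) :=
    { toFun := fun k => if k ∈ F then SignType.sign (r k) else 0
      continuous_toFun := continuous_of_discreteTopology
      zero_at_infty' := by
        rw [cocompact_eq_cofinite]
        refine tendsto_const_nhds.congr' ?_
        filter_upwards [F.finite_toSet.compl_mem_cofinite] with k hk
        exact (if_neg hk).symm }
  have hx (k : ℕ) : x k = if k ∈ F then (SignType.sign (r k) : ℝ) else 0 := rfl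
  have hnorm : ‖x‖ ≤ 1 := by
    refine (BoundedContinuousFunction.norm_le (f := x.toBCF) zero_le_one).mpr fun k => ?_
    change ‖x k‖ ≤ 1
    rw [hx]
    split_ifs
    · rcases lt_trichotomy (r k) 0 with h | h | h <;> simp [h]
    · simp
  have heq : c0Functional r hr x = ∑ k ∈ F, |r k| := by
    rw [c0Functional_apply, tsum_eq_sum (s := F) fun k hk => by simp [hx, hk]]
    refine Finset.sum_congr rfl fun k hk => ?_
    rw [hx, if_pos hk, self_mul_sign]
  calc ∑ k ∈ F, |r k| ≤ ‖c0Functional r hr x‖ := heq ▸ le_abs_self _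
    _ ≤ ‖c0Functional r hr‖ * ‖x‖ := (c0Functional r hr).le_opNorm x
    _ ≤ ‖c0Functional r hr‖ := mul_le_of_le_one_right (ContinuousLinearMap.opNorm_nonneg _) hnorm

theorem CondT1.of_bdd_matMul {a : ℕ → ℕ → ℝ} (hs : ∀ n, Summable (a n))
    (h : ∀ x : C₀(ℕ, ℝ), Bdd (matMul a x)) : CondT1 a := by
  obtain ⟨C, hC⟩ := banach_steinhaus (g := fun n => c0Functional (a n) (hs n)) h
  exact ⟨C, fun n F => (sum_abs_le_norm_c0Functional (a n) (hs n) F).trans (hC n)⟩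

theorem IJRegular.summable {J : Set (Set ℕ)} {a : ℕ → ℕ → ℝ}
    (h : IJRegular {E : Set ℕ | E.Finite} J a) (n : ℕ) : Summable (a n) := by
  simpa using (h (fun _ => 1) ⟨1, by simp⟩ 1 (idealLim_finite_iff.mpr tendsto_const_nhds)).1 n

theorem IJRegular.condT1 {J : Set (Set ℕ)} {a : ℕ → ℕ → ℝ}
    (h : IJRegular {E : Set ℕ | E.Finite} J a) : CondT1 a := by
  refine .of_bdd_matMul h.summable fun x =>
    (h x ⟨‖x‖, x.abs_apply_le_norm⟩ 0 (idealLim_finite_iff.mpr ?_)).2.1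
  exact cocompact_eq_cofinite ℕ ▸ x.zero_at_infty'

theorem IJRegular.condT2 {J : Set (Set ℕ)} {a : ℕ → ℕ → ℝ}
    (h : IJRegular {E : Set ℕ | E.Finite} J a) : CondT2 J a := by
  refine ⟨h.summable, ?_⟩
  have := (h (fun _ => 1) ⟨1, by simp⟩ 1 (idealLim_finite_iff.mpr tendsto_const_nhds)).2.2
  unfold matMul at this
  simpa only [mul_one] using this

theorem IJRegular.idealLim_column {J : Set (Set ℕ)} {a : ℕ → ℕ → ℝ}
    (h : IJRegular {E : Set ℕ | E.Finite} J a) (k : ℕ) : IdealLim J (fun n => a n k) 0 := by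
  have hlim : Tendsto (Pi.single k 1 : ℕ → ℝ) cofinite (𝓝 0) := by
    refine tendsto_const_nhds.congr' ?_
    filter_upwards [(Set.finite_singleton k).compl_mem_cofinite] with j hj
    exact (Pi.single_eq_of_ne (M := fun _ => ℝ) hj 1).symm
  have hb : Bdd (Pi.single k 1 : ℕ → ℝ) := ⟨1, fun j => by
    rcases eq_or_ne j k with rfl | hj <;> simp [*]⟩
  have heq : matMul a (Pi.single k 1) = fun n => a n k := by
    ext n
    rw [matMul, tsum_eq_single k fun j hj => by simp [hj]]
    simp
  exact heq ▸ (h _ hb 0 (idealLim_finite_iff.mpr hlim)).2.2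

theorem IJRegular.of_conditions {J : Set (Set ℕ)} (hJ : IsAdmissibleIdeal J) {a : ℕ → ℕ → ℝ}
    (h1 : CondT1 a) (h2 : CondT2 J a) (h3 : CondT3 {E : Set ℕ | E.Finite} J a) :
    IJRegular {E : Set ℕ | E.Finite} J a := by
  rintro x ⟨M, hM⟩ η hx
  obtain ⟨C, hC⟩ := h1
  obtain ⟨hs, hsum⟩ := h2
  have hrow (n : ℕ) : ∑' k, |a n k| ≤ C := (hs n).abs.tsum_le_of_sum_le (hC n)
  have hC0 : 0 ≤ C := by simpa using hC 0 ∅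
  have hM0 : 0 ≤ M := (abs_nonneg _).trans (hM 0)
  have hax (n : ℕ) : Summable fun k => a n k * x k := (hs n).mul_of_abs_le hM
  refine ⟨hax, ⟨C * M, fun n => (abs_tsum_mul_le (hs n) hM).trans
    (mul_le_mul_of_nonneg_right (hrow n) hM0)⟩, fun ε hε => ?_⟩
  set K := M + |η| with hK
  have hK0 : 0 ≤ K := by positivity
  have hbound (k : ℕ) : |x k - η| ≤ K := (abs_sub _ _).trans (by linarith [hM k])
  let d := ε / (C + K + |η| + 1)
  have hd : 0 < d := by positivity
  have hdε : d * (C + K + |η| + 1) = ε := div_mul_cancel₀ _ (by positivity)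
  let E : Set ℕ := {k | d < |x k - η|}
  have hE : E.Finite := hx d hd
  refine hJ.1 _ (hJ.2.1 _ (hsum d hd) _ (h3 E hE d hd)) _ fun n hn => ?_
  by_contra hc
  simp only [Set.mem_union, Set.mem_ofPred_eq, not_or, not_lt, sub_zero] at hc hn
  obtain ⟨hcsum, hcE⟩ := hc
  have hsplit : matMul a x n - η
      = ∑' k, a n k * (x k - η) + η * (∑' k, a n k - 1) := by
    simp only [mul_sub, matMul]
    rw [(hax n).tsum_sub ((hs n).mul_right η), tsum_mul_right]
    ring
  have hind : Summable (E.indicator fun j => |a n j|) := (hs n).abs.indicator E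
  have hmain : |∑' k, a n k * (x k - η)|
      ≤ (∑' k, |a n k|) * d + (∑' k, E.indicator (fun j => |a n j|) k) * K := by
    rw [← tsum_mul_right, ← tsum_mul_right, ← Real.norm_eq_abs,
      ← ((hs n).abs.mul_right d).tsum_add (hind.mul_right K)]
    refine tsum_of_norm_bounded (((hs n).abs.mul_right d).add (hind.mul_right K)).hasSum
      fun k => ?_
    rw [Real.norm_eq_abs, abs_mul]
    by_cases hk : k ∈ E
    · rw [Set.indicator_of_mem hk]
      nlinarith [mul_le_mul_of_nonneg_left (hbound k) (abs_nonneg (a n k)),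
        mul_nonneg (abs_nonneg (a n k)) hd.le]
    · rw [Set.indicator_of_notMem hk, zero_mul, add_zero]
      exact mul_le_mul_of_nonneg_left (not_lt.mp hk) (abs_nonneg _)
  have hη : |η * (∑' k, a n k - 1)| ≤ |η| * d := by
    rw [abs_mul]
    exact mul_le_mul_of_nonneg_left hcsum (abs_nonneg _)
  have htri := abs_add_le (∑' k, a n k * (x k - η)) (η * (∑' k, a n k - 1))
  rw [← hsplit] at htri
  have hrowd := mul_le_mul_of_nonneg_right (hrow n) hd.le
  have hEK := mul_le_mul_of_nonneg_right ((le_abs_self _).trans hcE) hK0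
  nlinarith

/-- For an admissible ideal `J` on `ℕ`, a matrix `A` is `(Fin, J)`-regular iff
it satisfies (T1), (T2), and (T3) for every finite set `E ⊆ ℕ`. -/
theorem fin_J_regular_iff (J : Set (Set ℕ)) (hJ : IsAdmissibleIdeal J)
    (a : ℕ → ℕ → ℝ) :
    IJRegular {E : Set ℕ | E.Finite} J a ↔
      (CondT1 a ∧ CondT2 J a ∧
        ∀ E : Set ℕ, E.Finite →
          IdealLim J (fun n => ∑' k, E.indicator (fun j => |a n j|) k) 0) := by
  refine ⟨fun h => ⟨h.condT1, h.condT2, fun E hE => ?_⟩,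
    fun ⟨h1, h2, h3⟩ => .of_conditions hJ h1 h2 h3⟩
  simp only [tsum_indicator_eq_sum hE]
  exact idealLim_sum_abs hJ h.idealLim_column hE.toFinset
end

section
/- Let I, J be admissible ideals on ℕ. An infinite real matrix A is (I, J)-regular if and only if A ∈ (c₀(I) ∩ ℓ∞, c₀(J) ∩ ℓ∞) and A satisfies (T2) J-lim_n ∑_k a_{n,k} = 1. -/
open Filter Topology

theorem idealLim_of_tendsto {I : Set (Set ℕ)} (hI : IsAdmissibleIdeal I) {x : ℕ → ℝ} {η : ℝ}
    (hx : Tendsto x atTop (𝓝 η)) : IdealLim I x η := by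
  intro ε hε
  refine hI.2.2.1 _ ?_
  have h : ∀ᶠ n in cofinite, dist (x n) η < ε := by
    rw [Nat.cofinite_eq_atTop]
    exact hx.eventually (Metric.ball_mem_nhds η hε)
  refine (eventually_cofinite.mp h).subset fun n hn => ?_
  simpa [Real.dist_eq] using le_of_lt hn

theorem IdealLim.add {J : Set (Set ℕ)} (hJ : IsAdmissibleIdeal J) {x y : ℕ → ℝ} {ξ η : ℝ}
    (hx : IdealLim J x ξ) (hy : IdealLim J y η) : IdealLim J (fun n => x n + y n) (ξ + η) := by
  intro ε hε
  refine hJ.1 _ (hJ.2.1 _ (hx (ε / 2) (half_pos hε)) _ (hy (ε / 2) (half_pos hε))) _ ?_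
  intro n hn
  simp only [Set.mem_union, Set.mem_ofPred_eq] at hn ⊢
  by_contra! hcon
  have h := abs_add_le (x n - ξ) (y n - η)
  rw [show x n - ξ + (y n - η) = x n + y n - (ξ + η) by ring] at h
  linarith [hcon.1, hcon.2]

theorem IdealLim.const_mul {J : Set (Set ℕ)} (hJ : IsAdmissibleIdeal J) {x : ℕ → ℝ} {ξ : ℝ}
    (hx : IdealLim J x ξ) (c : ℝ) : IdealLim J (fun n => c * x n) (c * ξ) := by
  intro ε hε
  have hc : 0 < |c| + 1 := by positivity
  refine hJ.1 _ (hx (ε / (|c| + 1)) (div_pos hε hc)) _ fun n hn => ?_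
  simp only [Set.mem_ofPred_eq] at hn ⊢
  rw [← mul_sub, abs_mul] at hn
  rw [div_lt_iff₀ hc]
  nlinarith [abs_nonneg (x n - ξ)]

open scoped ZeroAtInfty in
/-- The functional on `c₀` given by pairing with a summable sequence. -/
noncomputable def summablePairing (b : ℕ → ℝ) (hb : Summable b) : C₀(ℕ, ℝ) →L[ℝ] ℝ :=
  have hbound (f : C₀(ℕ, ℝ)) (k : ℕ) : ‖b k * f k‖ ≤ ‖b k‖ * ‖f‖ := by
    rw [norm_mul]
    exact mul_le_mul_of_nonneg_left (f.toBCF.norm_coe_le_norm k) (norm_nonneg _)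
  have hsum (f : C₀(ℕ, ℝ)) : Summable fun k => b k * f k :=
    .of_norm_bounded (hb.norm.mul_right ‖f‖) (hbound f)
  LinearMap.mkContinuous
    { toFun := fun f => ∑' k, b k * f k
      map_add' := fun f g => by
        simp only [ZeroAtInftyContinuousMap.add_apply, mul_add]
        exact (hsum f).tsum_add (hsum g)
      map_smul' := fun c f => by
        simp only [ZeroAtInftyContinuousMap.smul_apply, smul_eq_mul, RingHom.id_apply,
          mul_left_comm _ c]
        exact tsum_mul_left }
    (∑' k, ‖b k‖)
    fun f => by
      rw [← tsum_mul_right]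
      exact tsum_of_norm_bounded (hb.norm.mul_right ‖f‖).hasSum (hbound f)

open scoped ZeroAtInfty in
theorem summablePairing_apply (b : ℕ → ℝ) (hb : Summable b) (f : C₀(ℕ, ℝ)) :
    summablePairing b hb f = ∑' k, b k * f k := rfl

open scoped ZeroAtInfty in
/-- The indicator of a finite set, as an element of `c₀`. -/
noncomputable def finsetIndicator (F : Finset ℕ) : C₀(ℕ, ℝ) where
  toFun := (F : Set ℕ).indicator 1
  continuous_toFun := continuous_of_discreteTopology
  zero_at_infty' := by
    rw [cocompact_eq_cofinite]
    refine tendsto_const_nhds.congr' ?_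
    filter_upwards [F.finite_toSet.compl_mem_cofinite] with k hk
    rw [Set.indicator_of_notMem hk]

theorem norm_finsetIndicator_le (F : Finset ℕ) : ‖finsetIndicator F‖ ≤ 1 := by
  rw [← ZeroAtInftyContinuousMap.norm_toBCF_eq_norm, BoundedContinuousFunction.norm_le zero_le_one]
  intro k
  change ‖(F : Set ℕ).indicator (1 : ℕ → ℝ) k‖ ≤ 1
  by_cases hk : k ∈ (F : Set ℕ) <;> simp [hk]

/-- A matrix mapping null sequences to bounded sequences has bounded row sums. -/
theorem bdd_tsum_of_bdd_matMul {a : ℕ → ℕ → ℝ} (ha : ∀ n, Summable (a n))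
    (h : ∀ x, Tendsto x atTop (𝓝 0) → Bdd (matMul a x)) : Bdd fun n => ∑' k, a n k := by
  obtain ⟨C, hC⟩ := banach_steinhaus (g := fun n => summablePairing (a n) (ha n)) fun f =>
    h f (by simpa [cocompact_eq_cofinite, Nat.cofinite_eq_atTop] using f.zero_at_infty')
  refine ⟨C, fun n => le_of_tendsto (ha n).hasSum.abs (.of_forall fun F => ?_)⟩
  have hF : summablePairing (a n) (ha n) (finsetIndicator F) = ∑ k ∈ F, a n k := by
    rw [summablePairing_apply, tsum_eq_sum (s := F)]
    · refine Finset.sum_congr rfl fun k hk => ?_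
      change a n k * (F : Set ℕ).indicator 1 k = _
      simp [hk]
    · intro k hk
      change a n k * (F : Set ℕ).indicator 1 k = _
      simp [hk]
  rw [← hF, ← Real.norm_eq_abs]
  calc _ ≤ ‖summablePairing (a n) (ha n)‖ * ‖finsetIndicator F‖ :=
        ContinuousLinearMap.le_opNorm _ _
    _ ≤ ‖summablePairing (a n) (ha n)‖ :=
        mul_le_of_le_one_right (ContinuousLinearMap.opNorm_nonneg _) (norm_finsetIndicator_le F)
    _ ≤ C := hC n

/-- For admissible ideals `I, J` on `ℕ`, a matrix `A` is `(I, J)`-regular iff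
`A ∈ (c₀(I) ∩ ℓ∞, c₀(J) ∩ ℓ∞)` and `A` satisfies (T2). -/
theorem regular_iff_c0_and_T2 (I J : Set (Set ℕ))
    (hI : IsAdmissibleIdeal I) (hJ : IsAdmissibleIdeal J) (a : ℕ → ℕ → ℝ) :
    IJRegular I J a ↔
      ((∀ x : ℕ → ℝ, Bdd x → IdealLim I x 0 →
          (∀ n, Summable fun k => a n k * x k) ∧ Bdd (matMul a x) ∧
            IdealLim J (matMul a x) 0) ∧
        CondT2 J a) := by
  constructor
  · intro h
    refine ⟨fun x hx hx0 => h x hx 0 hx0, ?_⟩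
    obtain ⟨hsum, -, hlim⟩ :=
      h (fun _ => 1) ⟨1, by simp⟩ 1 (idealLim_of_tendsto hI tendsto_const_nhds)
    have hmul : matMul a (fun _ => 1) = fun n => ∑' k, a n k := by
      ext n
      simp [matMul]
    exact ⟨by simpa using hsum, hmul ▸ hlim⟩
  · rintro ⟨h, ha, hlim⟩ x ⟨C, hC⟩ η hη
    have hnull (y : ℕ → ℝ) (hy : Tendsto y atTop (𝓝 0)) : Bdd (matMul a y) := by
      obtain ⟨D, hD⟩ := (Metric.isBounded_range_of_tendsto y hy).exists_norm_le
      exact (h y ⟨D, fun n => hD _ ⟨n, rfl⟩⟩ (idealLim_of_tendsto hI hy)).2.1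
    obtain ⟨R, hR⟩ := bdd_tsum_of_bdd_matMul ha hnull
    obtain ⟨hsum, ⟨B, hB⟩, hlim0⟩ := h (fun k => x k - η)
      ⟨C + |η|, fun n => (abs_sub _ _).trans (by grw [hC n])⟩ (by simpa [IdealLim] using hη)
    have hsplit (n : ℕ) : (fun k => a n k * x k) = fun k => a n k * (x k - η) + η * a n k := by
      ext k
      ring
    have hmul : matMul a x = fun n => matMul a (fun k => x k - η) n + η * ∑' k, a n k := by
      ext n
      simp only [matMul]
      rw [hsplit, (hsum n).tsum_add ((ha n).mul_left η), tsum_mul_left]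
    refine ⟨fun n => ?_, ⟨B + |η| * R, fun n => ?_⟩, ?_⟩
    · rw [hsplit]
      exact (hsum n).add ((ha n).mul_left η)
    · rw [hmul]
      grw [abs_add_le, abs_mul, hB n, hR n]
    · rw [hmul]
      simpa using hlim0.add hJ (hlim.const_mul hJ η)
end

section
/- Let I be an admissible ideal on ℕ with Fin ⊊ I ⊆ Z, where Z is the ideal of asymptotic density zero sets. Then there exist an infinite real matrix A = (a_{n,k}) with A ∈ (ℓ∞, c₀(Z) ∩ ℓ∞) and a set E ∈ I such that the sequence (∑_{k∈E} |a_{n,k}|)_n does not Z-converge to 0. In particular, A ∈ (c₀(I) ∩ ℓ∞, c₀(Z) ∩ ℓ∞) but A fails condition (T3) for the pair (I, Z). -/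
open Filter Topology

/-- The sign `(-1) ^ b`, where `b` is the `i`-th binary digit of `n`. -/
noncomputable def bitSign (n i : ℕ) : ℝ := if n.testBit i then -1 else 1

lemma abs_bitSign (n i : ℕ) : |bitSign n i| = 1 := by
  unfold bitSign; split <;> simp

lemma bitSign_two_pow_add_of_lt {i j : ℕ} (h : i < j) (n : ℕ) :
    bitSign (2 ^ j + n) i = bitSign n i := by
  simp [bitSign, Nat.testBit_two_pow_add_gt h]

lemma bitSign_of_lt_two_pow {j n : ℕ} (h : n < 2 ^ j) : bitSign n j = 1 := by
  simp [bitSign, Nat.testBit_lt_two_pow h]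

lemma bitSign_two_pow_add_self {j n : ℕ} (h : n < 2 ^ j) : bitSign (2 ^ j + n) j = -1 := by
  simp [bitSign, Nat.testBit_two_pow_add_eq, Nat.testBit_lt_two_pow h]

lemma sum_range_two_pow_succ (f : ℕ → ℝ) (j : ℕ) :
    ∑ n ∈ Finset.range (2 ^ (j + 1)), f n =
      ∑ n ∈ Finset.range (2 ^ j), f n + ∑ n ∈ Finset.range (2 ^ j), f (2 ^ j + n) := by
  rw [pow_succ, mul_two, Finset.sum_range_add]

/-- Orthogonality of the binary digit signs on `{0, …, 2 ^ j - 1}`. -/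
lemma sum_sq_add_sum_bitSign (y : ℕ → ℝ) (j : ℕ) (c : ℝ) :
    ∑ n ∈ Finset.range (2 ^ j), (c + ∑ i ∈ Finset.range j, bitSign n i * y i) ^ 2 =
      2 ^ j * (c ^ 2 + ∑ i ∈ Finset.range j, y i ^ 2) := by
  induction j generalizing c with
  | zero => simp
  | succ j ih =>
    have h₁ : ∑ n ∈ Finset.range (2 ^ j),
        (c + ∑ i ∈ Finset.range (j + 1), bitSign n i * y i) ^ 2 =
        ∑ n ∈ Finset.range (2 ^ j),
          ((c + y j) + ∑ i ∈ Finset.range j, bitSign n i * y i) ^ 2 := by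
      refine Finset.sum_congr rfl fun n hn => ?_
      rw [Finset.sum_range_succ, bitSign_of_lt_two_pow (Finset.mem_range.1 hn)]
      ring
    have h₂ : ∑ n ∈ Finset.range (2 ^ j),
        (c + ∑ i ∈ Finset.range (j + 1), bitSign (2 ^ j + n) i * y i) ^ 2 =
        ∑ n ∈ Finset.range (2 ^ j),
          ((c - y j) + ∑ i ∈ Finset.range j, bitSign n i * y i) ^ 2 := by
      refine Finset.sum_congr rfl fun n hn => ?_
      rw [Finset.sum_range_succ, bitSign_two_pow_add_self (Finset.mem_range.1 hn),
        Finset.sum_congr rfl fun i hi => by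
          rw [bitSign_two_pow_add_of_lt (Finset.mem_range.1 hi)]]
      ring
    rw [sum_range_two_pow_succ, h₁, h₂, ih, ih, Finset.sum_range_succ]
    ring

/-- The `n`-th average of `y`: the mean of the first `log₂ n` terms of `y`, with signs given by
the binary digits of `n` (normalised by `log₂ n + 1`). -/
noncomputable def bitAverage (y : ℕ → ℝ) (n : ℕ) : ℝ :=
  ∑ i ∈ Finset.range (Nat.log 2 n), bitSign n i / (Nat.log 2 n + 1) * y i

lemma bitAverage_two_pow_add (y : ℕ → ℝ) {j n : ℕ} (h : n < 2 ^ j) :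
    bitAverage y (2 ^ j + n) = (∑ i ∈ Finset.range j, bitSign n i * y i) / (j + 1) := by
  have hlog : Nat.log 2 (2 ^ j + n) = j :=
    Nat.log_eq_of_pow_le_of_lt_pow (by omega) (by rw [pow_succ]; omega)
  rw [bitAverage, hlog, Finset.sum_div]
  refine Finset.sum_congr rfl fun i hi => ?_
  rw [bitSign_two_pow_add_of_lt (Finset.mem_range.1 hi)]
  ring

lemma abs_bitAverage_le {y : ℕ → ℝ} {C : ℝ} (hy : ∀ i, |y i| ≤ C) (n : ℕ) :
    |bitAverage y n| ≤ C := by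
  have hC : 0 ≤ C := (abs_nonneg _).trans (hy 0)
  have hpos : (0 : ℝ) < Nat.log 2 n + 1 := by positivity
  calc |bitAverage y n|
      ≤ ∑ i ∈ Finset.range (Nat.log 2 n), |bitSign n i / (Nat.log 2 n + 1) * y i| :=
        Finset.abs_sum_le_sum_abs _ _
    _ ≤ ∑ i ∈ Finset.range (Nat.log 2 n), 1 / ((Nat.log 2 n : ℝ) + 1) * C := by
        refine Finset.sum_le_sum fun i _ => ?_
        rw [abs_mul, abs_div, abs_bitSign, abs_of_pos hpos]
        gcongr
        exact hy i
    _ = Nat.log 2 n / ((Nat.log 2 n : ℝ) + 1) * C := by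
        rw [Finset.sum_const, Finset.card_range, nsmul_eq_mul]; ring
    _ ≤ 1 * C := by
        gcongr
        rw [div_le_one hpos]
        linarith
    _ = C := one_mul C

lemma sum_sq_bitAverage_le {y : ℕ → ℝ} {C : ℝ} (hy : ∀ i, |y i| ≤ C) (j : ℕ) :
    ∑ n ∈ Finset.range (2 ^ j), bitAverage y n ^ 2 ≤ 3 * C ^ 2 * 2 ^ j / (j + 1) := by
  induction j with
  | zero =>
    simp only [pow_zero, Finset.sum_range_one, bitAverage, Nat.log_zero_right,
      Finset.range_zero, Finset.sum_empty, zero_pow two_ne_zero]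
    positivity
  | succ j ih =>
    have hblock : ∑ n ∈ Finset.range (2 ^ j), bitAverage y (2 ^ j + n) ^ 2 ≤
        2 ^ j * (j * C ^ 2) / (j + 1) ^ 2 := by
      have horth := sum_sq_add_sum_bitSign y j 0
      simp only [zero_add, zero_pow two_ne_zero] at horth
      rw [Finset.sum_congr rfl fun n hn => by
        rw [bitAverage_two_pow_add y (Finset.mem_range.1 hn), div_pow], ← Finset.sum_div, horth]
      gcongr
      calc ∑ i ∈ Finset.range j, y i ^ 2 ≤ ∑ i ∈ Finset.range j, C ^ 2 :=
            Finset.sum_le_sum fun i _ => sq_le_sq' (abs_le.1 (hy i)).1 (abs_le.1 (hy i)).2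
        _ = j * C ^ 2 := by simp
    have hstep : 3 * C ^ 2 * 2 ^ j / ((j : ℝ) + 1) + 2 ^ j * (j * C ^ 2) / ((j : ℝ) + 1) ^ 2 ≤
        3 * C ^ 2 * 2 ^ (j + 1) / (((j + 1 : ℕ) : ℝ) + 1) := by
      have hdiff : 3 * C ^ 2 * 2 ^ (j + 1) / (((j + 1 : ℕ) : ℝ) + 1) -
          (3 * C ^ 2 * 2 ^ j / ((j : ℝ) + 1) + 2 ^ j * (j * C ^ 2) / ((j : ℝ) + 1) ^ 2) =
          C ^ 2 * 2 ^ j * (2 * j ^ 2 + j) / ((j + 1) ^ 2 * (j + 2)) := by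
        push_cast
        field_simp
        ring
      have : 0 ≤ C ^ 2 * 2 ^ j * (2 * (j : ℝ) ^ 2 + j) / ((j + 1) ^ 2 * (j + 2)) := by
        positivity
      linarith
    rw [sum_range_two_pow_succ]
    linarith

lemma idealLim_bitAverage {y : ℕ → ℝ} (hy : Bdd y) :
    IdealLim densityZeroIdeal (bitAverage y) 0 := by
  obtain ⟨C, hC⟩ := hy
  intro ε hε
  have hlog : Tendsto (fun N : ℕ => ((Nat.log 2 N : ℕ) : ℝ)) atTop atTop :=
    tendsto_natCast_atTop_atTop.comp
      (tendsto_atTop_atTop.2 fun b => ⟨2 ^ b, fun _ h => Nat.le_log_of_pow_le one_lt_two h⟩)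
  have hlim : Tendsto (fun N : ℕ => 6 * C ^ 2 / ε ^ 2 / ((Nat.log 2 N : ℝ) + 2)) atTop (𝓝 0) :=
    (tendsto_atTop_add_const_right _ _ hlog).const_div_atTop _
  refine squeeze_zero' (Eventually.of_forall fun N => ?_) ?_ hlim
  · exact div_nonneg (Finset.sum_nonneg fun _ _ =>
      Set.indicator_nonneg (fun _ _ => zero_le_one) _) N.cast_nonneg
  filter_upwards [eventually_ge_atTop 1] with N hN
  have hN' : (0 : ℝ) < N := by exact_mod_cast hN
  set J := Nat.log 2 N with hJ
  have hlt : N < 2 ^ (J + 1) := Nat.lt_pow_succ_log_self one_lt_two N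
  have hle : (2 : ℝ) ^ J ≤ N := by exact_mod_cast Nat.pow_log_le_self 2 (by omega : N ≠ 0)
  have hcheb : ε ^ 2 * ∑ k ∈ Finset.Icc 1 N,
      {n : ℕ | ε < |bitAverage y n - 0|}.indicator (fun _ => (1 : ℝ)) k ≤
      ∑ n ∈ Finset.range (2 ^ (J + 1)), bitAverage y n ^ 2 := by
    rw [Finset.mul_sum]
    calc _ ≤ ∑ n ∈ Finset.Icc 1 N, bitAverage y n ^ 2 := by
          refine Finset.sum_le_sum fun k _ => ?_
          by_cases hk : ε < |bitAverage y k|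
          · rw [Set.indicator_of_mem (by simpa using hk), mul_one, ← sq_abs (bitAverage y k)]
            gcongr
          · rw [Set.indicator_of_notMem (by simpa using hk), mul_zero]
            positivity
      _ ≤ _ := by
          refine Finset.sum_le_sum_of_subset_of_nonneg (fun k hk => ?_) fun _ _ _ => sq_nonneg _
          rw [Finset.mem_Icc] at hk
          exact Finset.mem_range.2 (by omega)
  have hbound : ε ^ 2 * ∑ k ∈ Finset.Icc 1 N,
      {n : ℕ | ε < |bitAverage y n - 0|}.indicator (fun _ => (1 : ℝ)) k ≤
      6 * C ^ 2 * N / (J + 2) := by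
    calc _ ≤ 3 * C ^ 2 * 2 ^ (J + 1) / (((J + 1 : ℕ) : ℝ) + 1) :=
          hcheb.trans (sum_sq_bitAverage_le hC _)
      _ = 6 * C ^ 2 * 2 ^ J / (J + 2) := by push_cast; ring
      _ ≤ _ := by gcongr
  rw [div_le_iff₀ hN']
  rw [← le_div_iff₀' (by positivity)] at hbound
  refine hbound.trans (le_of_eq ?_)
  field_simp

/-- The matrix averaging, with binary digit signs, along the subsequence `e`. -/
noncomputable def bitMatrix (e : ℕ → ℕ) (n : ℕ) : ℕ → ℝ :=
  Function.extend e
    (fun i => if i < Nat.log 2 n then bitSign n i / (Nat.log 2 n + 1) else 0) 0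

lemma hasSum_bitMatrix_mul {e : ℕ → ℕ} (he : e.Injective) (x : ℕ → ℝ) (n : ℕ) :
    HasSum (fun k => bitMatrix e n k * x k) (bitAverage (x ∘ e) n) := by
  rw [← he.hasSum_iff fun k hk => by
    rw [bitMatrix, Function.extend_apply' _ _ _ (by simpa using hk)]; simp]
  have h : bitAverage (x ∘ e) n = ∑ i ∈ Finset.range (Nat.log 2 n),
      ((fun k => bitMatrix e n k * x k) ∘ e) i := by
    refine Finset.sum_congr rfl fun i hi => ?_
    simp [bitMatrix, he.extend_apply, Finset.mem_range.1 hi]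
  rw [h]
  refine hasSum_sum_of_ne_finset_zero fun i hi => ?_
  rw [Finset.mem_range] at hi
  simp [bitMatrix, he.extend_apply, hi]

lemma hasSum_indicator_abs_bitMatrix {e : ℕ → ℕ} (he : e.Injective) {E : Set ℕ}
    (hE : ∀ i, e i ∈ E) (n : ℕ) :
    HasSum (fun k => E.indicator (fun j => |bitMatrix e n j|) k)
      (Nat.log 2 n / (Nat.log 2 n + 1)) := by
  rw [← he.hasSum_iff fun k hk => by
    rw [Set.indicator_apply_eq_zero]
    intro _
    rw [bitMatrix, Function.extend_apply' _ _ _ (by simpa using hk)]; simp]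
  have h : (Nat.log 2 n / (Nat.log 2 n + 1) : ℝ) = ∑ i ∈ Finset.range (Nat.log 2 n),
      ((fun k => E.indicator (fun j => |bitMatrix e n j|) k) ∘ e) i := by
    have hpos : (0 : ℝ) < Nat.log 2 n + 1 := by positivity
    rw [Finset.sum_congr rfl (g := fun _ => 1 / ((Nat.log 2 n : ℝ) + 1)) fun i hi => by
      simp [bitMatrix, he.extend_apply, Finset.mem_range.1 hi, hE, abs_div, abs_bitSign,
        abs_of_pos hpos]]
    rw [Finset.sum_const, Finset.card_range, nsmul_eq_mul]
    ring
  rw [h]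
  refine hasSum_sum_of_ne_finset_zero fun i hi => ?_
  rw [Finset.mem_range] at hi
  simp [bitMatrix, he.extend_apply, hi, hE]

lemma notMem_densityZeroIdeal_of_Ici_subset {S : Set ℕ} (hS : Set.Ici 2 ⊆ S) :
    S ∉ densityZeroIdeal := by
  intro h
  have hlt := (tendsto_order.1 h).2 (1 / 2) (by norm_num)
  obtain ⟨N, hN, hN2⟩ := (hlt.and (eventually_ge_atTop 2)).exists
  have hpos : (2 : ℝ) ≤ N := by exact_mod_cast hN2
  rw [div_lt_iff₀ (by linarith)] at hN
  have hcount : (N : ℝ) - 1 ≤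
      ∑ k ∈ Finset.Icc 1 N, S.indicator (fun _ => (1 : ℝ)) k := by
    calc (N : ℝ) - 1 = ∑ k ∈ Finset.Icc 2 N, S.indicator (fun _ => (1 : ℝ)) k := by
          rw [Finset.sum_congr rfl fun k hk =>
            Set.indicator_of_mem (hS (Finset.mem_Icc.1 hk).1) _]
          simp only [Finset.sum_const, Nat.card_Icc, nsmul_eq_mul, mul_one]
          rw [show N + 1 - 2 = N - 1 by omega, Nat.cast_sub (by omega), Nat.cast_one]
      _ ≤ _ := Finset.sum_le_sum_of_subset_of_nonneg
          (Finset.Icc_subset_Icc_left one_le_two)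
          fun _ _ _ => Set.indicator_nonneg (fun _ _ => zero_le_one) _
  linarith

lemma not_idealLim_indicator_abs_bitMatrix {e : ℕ → ℕ} (he : e.Injective) {E : Set ℕ}
    (hE : ∀ i, e i ∈ E) :
    ¬ IdealLim densityZeroIdeal
      (fun n => ∑' k, E.indicator (fun j => |bitMatrix e n j|) k) 0 := by
  intro h
  refine notMem_densityZeroIdeal_of_Ici_subset (fun n hn => ?_) (h (1 / 4) (by norm_num))
  have hlog : (1 : ℝ) ≤ Nat.log 2 n := by
    exact_mod_cast Nat.log_pos one_lt_two hn
  change 1 / 4 < |(∑' k, E.indicator (fun j => |bitMatrix e n j|) k) - 0|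
  rw [(hasSum_indicator_abs_bitMatrix he hE n).tsum_eq, sub_zero]
  refine lt_of_lt_of_le ?_ (le_abs_self _)
  rw [lt_div_iff₀ (by linarith)]
  linarith

/-- If `I` is an admissible ideal with `Fin ⊊ I ⊆ Z`, then there exist a matrix
`A ∈ (ℓ∞, c₀(Z) ∩ ℓ∞)` and a set `E ∈ I` such that `(∑_{k ∈ E} |a n k|)ₙ` does
not `Z`-converge to `0`; in particular `A ∈ (c₀(I) ∩ ℓ∞, c₀(Z) ∩ ℓ∞)` but `A`
fails condition (T3) for the pair `(I, Z)`. -/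
theorem exists_linf_c0Z_not_T3 (I : Set (Set ℕ)) (hI : IsAdmissibleIdeal I)
    (hFin : {E : Set ℕ | E.Finite} ⊂ I) (hIZ : I ⊆ densityZeroIdeal) :
    ∃ a : ℕ → ℕ → ℝ,
      (∀ x : ℕ → ℝ, Bdd x →
        (∀ n, Summable fun k => a n k * x k) ∧ Bdd (matMul a x) ∧
          IdealLim densityZeroIdeal (matMul a x) 0) ∧
      (∃ E ∈ I, ¬ IdealLim densityZeroIdeal
        (fun n => ∑' k, E.indicator (fun j => |a n j|) k) 0) ∧
      (∀ x : ℕ → ℝ, Bdd x → IdealLim I x 0 →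
        (∀ n, Summable fun k => a n k * x k) ∧ Bdd (matMul a x) ∧
          IdealLim densityZeroIdeal (matMul a x) 0) ∧
      ¬ CondT3 I densityZeroIdeal a := by
  obtain ⟨E, hEI, hEinf⟩ := Set.exists_of_ssubset hFin
  obtain ⟨e, he, hE⟩ : ∃ e : ℕ → ℕ, e.Injective ∧ ∀ i, e i ∈ E :=
    ⟨_, Subtype.val_injective.comp (Set.Infinite.natEmbedding E hEinf).injective,
      fun _ => Subtype.prop _⟩
  have hmap : ∀ x : ℕ → ℝ, Bdd x →
      (∀ n, Summable fun k => bitMatrix e n k * x k) ∧ Bdd (matMul (bitMatrix e) x) ∧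
        IdealLim densityZeroIdeal (matMul (bitMatrix e) x) 0 := by
    rintro x ⟨C, hC⟩
    have hmul : matMul (bitMatrix e) x = bitAverage (x ∘ e) :=
      funext fun n => (hasSum_bitMatrix_mul he x n).tsum_eq
    rw [hmul]
    exact ⟨fun n => (hasSum_bitMatrix_mul he x n).summable,
      ⟨C, abs_bitAverage_le fun i => hC (e i)⟩, idealLim_bitAverage ⟨C, fun i => hC (e i)⟩⟩
  have hnot := not_idealLim_indicator_abs_bitMatrix he hE
  exact ⟨bitMatrix e, hmap, ⟨E, hEI, hnot⟩, fun x hx _ => hmap x hx, fun h => hnot (h E hEI)⟩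
end

section
/- Let σ be a permutation of ℕ and let I, J be admissible ideals on ℕ such that J is not maximal. Then the following are equivalent: (P1a) σ(x) ∈ c(J) and J-lim σ(x) = I-lim x for every x ∈ c(I); (P2a) σ(x) ∈ c(J) for every x ∈ c(I); (P1b) σ(x) ∈ c₀(J) for every x ∈ c₀(I); (P2b) σ(x) ∈ c(J) for every x ∈ c₀(I); (P3) σ(E) ∈ J for every E ∈ I; (P6) the permutation matrix A_σ is (I, J)-regular; (P7) σ(x) ∈ c₀(J) ∩ ℓ∞ for every x ∈ c₀(I) ∩ ℓ∞. -/
open Filter Topology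

/-- The indicator of an `I`-small set tends to `0` along `I`. -/
theorem IsAdmissibleIdeal.idealLim_indicator {I : Set (Set ℕ)} (hI : IsAdmissibleIdeal I)
    {E : Set ℕ} (hE : E ∈ I) : IdealLim I (E.indicator fun _ => (1 : ℝ)) 0 := by
  intro ε hε
  refine hI.1 E hE _ fun n hn => ?_
  by_contra h
  simp only [Set.mem_ofPred_eq, Set.indicator_of_notMem h, sub_zero, abs_zero] at hn
  linarith

/-- If an indicator has a limit along `J`, the set or its complement is `J`-small. -/
theorem IsAdmissibleIdeal.mem_or_compl_mem_of_idealLim_indicator {J : Set (Set ℕ)}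
    (hJ : IsAdmissibleIdeal J) {S : Set ℕ} {η : ℝ}
    (h : IdealLim J (S.indicator fun _ => (1 : ℝ)) η) : S ∈ J ∨ Sᶜ ∈ J := by
  by_cases hη : η = 1
  · right
    refine hJ.1 _ (h (1 / 2) (by norm_num)) _ fun n hn => ?_
    simp only [Set.mem_ofPred_eq, Set.indicator_of_notMem hn, hη]
    norm_num
  · left
    have hpos : 0 < |1 - η| := abs_pos.2 (sub_ne_zero.2 (Ne.symm hη))
    refine hJ.1 _ (h (|1 - η| / 2) (by linarith)) _ fun n hn => ?_
    simp only [Set.mem_ofPred_eq, Set.indicator_of_mem hn]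
    linarith

/-- A set whose indicator tends to `0` along `J` is `J`-small. -/
theorem IsAdmissibleIdeal.mem_of_idealLim_indicator_zero {J : Set (Set ℕ)}
    (hJ : IsAdmissibleIdeal J) {S : Set ℕ}
    (h : IdealLim J (S.indicator fun _ => (1 : ℝ)) 0) : S ∈ J := by
  refine hJ.1 _ (h (1 / 2) (by norm_num)) _ fun n hn => ?_
  simp only [Set.mem_ofPred_eq, Set.indicator_of_mem hn]
  norm_num

theorem indicator_comp_perm_symm (σ : Equiv.Perm ℕ) (E : Set ℕ) :
    (fun n => E.indicator (fun _ => (1 : ℝ)) (σ.symm n)) =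
      ((fun n => σ n) '' E).indicator fun _ => (1 : ℝ) := by
  funext n
  have hmem : n ∈ (fun n => σ n) '' E ↔ σ.symm n ∈ E := Equiv.image_eq_preimage_symm σ E ▸ Iff.rfl
  by_cases h : σ.symm n ∈ E
  · rw [Set.indicator_of_mem h, Set.indicator_of_mem (hmem.2 h)]
  · rw [Set.indicator_of_notMem h, Set.indicator_of_notMem (mt hmem.1 h)]

theorem Bdd.comp {x : ℕ → ℝ} (hx : Bdd x) (f : ℕ → ℕ) : Bdd fun n => x (f n) :=
  hx.imp fun _ hC n => hC (f n)

theorem bdd_indicator_one (E : Set ℕ) : Bdd (E.indicator fun _ => (1 : ℝ)) := by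
  refine ⟨1, fun n => ?_⟩
  by_cases h : n ∈ E <;> simp [h]

theorem IdealLim.comp_perm_symm {I J : Set (Set ℕ)} {σ : Equiv.Perm ℕ}
    (h : ∀ E ∈ I, (fun n => σ n) '' E ∈ J) {x : ℕ → ℝ} {η : ℝ} (hx : IdealLim I x η) :
    IdealLim J (fun n => x (σ.symm n)) η := by
  intro ε hε
  have key := h _ (hx ε hε)
  rwa [show (fun n => σ n) '' {n | ε < |x n - η|} = {n | ε < |x (σ.symm n) - η|} from
    Equiv.image_eq_preimage_symm σ _] at key

theorem matMul_single (f : ℕ → ℕ) (x : ℕ → ℝ) :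
    matMul (fun n k => if k = f n then (1 : ℝ) else 0) x = fun n => x (f n) := by
  funext n
  simp [matMul]

theorem summable_single_mul (m : ℕ) (x : ℕ → ℝ) :
    Summable fun k => (if k = m then (1 : ℝ) else 0) * x k :=
  summable_of_ne_finset_zero (s := {m}) fun k hk => by
    rw [if_neg (by simpa using hk), zero_mul]

/-- If a permutation carries every `I`-null sequence to a `J`-convergent one and `J` is not
maximal, then it maps `I`-small sets to `J`-small sets. -/
theorem IsAdmissibleIdeal.image_mem_of_exists_idealLim {σ : Equiv.Perm ℕ} {I J : Set (Set ℕ)}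
    (hI : IsAdmissibleIdeal I) (hJ : IsAdmissibleIdeal J)
    (hJmax : ¬ ∀ S : Set ℕ, S ∈ J ∨ Sᶜ ∈ J)
    (h : ∀ x : ℕ → ℝ, IdealLim I x 0 → ∃ η, IdealLim J (fun n => x (σ.symm n)) η) :
    ∀ E ∈ I, (fun n => σ n) '' E ∈ J := by
  have key : ∀ E ∈ I, (fun n => σ n) '' E ∈ J ∨ ((fun n => σ n) '' E)ᶜ ∈ J := by
    intro E hE
    obtain ⟨η, hη⟩ := h _ (hI.idealLim_indicator hE)
    rw [indicator_comp_perm_symm] at hη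
    exact hJ.mem_or_compl_mem_of_idealLim_indicator hη
  intro E hE
  by_contra hF
  have hFc := (key E hE).resolve_left hF
  refine hJmax fun S => ?_
  have himage : (fun n => σ n) '' (E ∩ (fun n => σ n) ⁻¹' S) = ((fun n => σ n) '' E) ∩ S :=
    Set.image_inter_preimage _ _ _
  have hS := key _ (hI.1 E hE (E ∩ (fun n => σ n) ⁻¹' S) Set.inter_subset_left)
  rw [himage] at hS
  refine hS.imp (fun hS => ?_) fun hS => ?_
  · refine hJ.1 _ (hJ.2.1 _ hS _ hFc) _ fun n hn => ?_
    by_cases hnF : n ∈ (fun n => σ n) '' E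
    · exact Or.inl ⟨hnF, hn⟩
    · exact Or.inr hnF
  · exact hJ.1 _ hS _ fun n hn hn' => hn hn'.2

/-- For a permutation `σ` of `ℕ` and admissible ideals `I, J` with `J` not
maximal, the conditions (P1a), (P2a), (P1b), (P2b), (P3), (P6) (the permutation
matrix `A_σ` is `(I, J)`-regular) and (P7) are all equivalent. Here
`σ(x) n = x (σ⁻¹ n)`. -/
theorem permutation_tfae (σ : Equiv.Perm ℕ) (I J : Set (Set ℕ))
    (hI : IsAdmissibleIdeal I) (hJ : IsAdmissibleIdeal J)
    (hJmax : ¬ ∀ S : Set ℕ, S ∈ J ∨ Sᶜ ∈ J) :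
    List.TFAE
      [ -- (P1a)
        ∀ (x : ℕ → ℝ) (η : ℝ), IdealLim I x η →
          IdealLim J (fun n => x (σ.symm n)) η,
        -- (P2a)
        ∀ x : ℕ → ℝ, (∃ η, IdealLim I x η) →
          ∃ η, IdealLim J (fun n => x (σ.symm n)) η,
        -- (P1b)
        ∀ x : ℕ → ℝ, IdealLim I x 0 → IdealLim J (fun n => x (σ.symm n)) 0,
        -- (P2b)
        ∀ x : ℕ → ℝ, IdealLim I x 0 → ∃ η, IdealLim J (fun n => x (σ.symm n)) η,
        -- (P3)
        ∀ E ∈ I, (fun n => σ n) '' E ∈ J,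
        -- (P6)
        IJRegular I J (fun n k => if k = σ.symm n then (1 : ℝ) else 0),
        -- (P7)
        ∀ x : ℕ → ℝ, Bdd x → IdealLim I x 0 →
          Bdd (fun n => x (σ.symm n)) ∧ IdealLim J (fun n => x (σ.symm n)) 0 ] := by
  tfae_have 1 → 2 := fun h x ⟨η, hx⟩ => ⟨η, h x η hx⟩
  tfae_have 1 → 3 := fun h x hx => h x 0 hx
  tfae_have 2 → 4 := fun h x hx => h x ⟨0, hx⟩
  tfae_have 3 → 4 := fun h x hx => ⟨0, h x hx⟩
  tfae_have 4 → 5 := hI.image_mem_of_exists_idealLim hJ hJmax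
  tfae_have 5 → 1 := fun h x η hx => hx.comp_perm_symm h
  tfae_have 1 → 6 := by
    intro h x hb η hx
    rw [matMul_single]
    exact ⟨fun n => summable_single_mul _ x, hb.comp _, h x η hx⟩
  tfae_have 6 → 7 := by
    intro h x hb hx
    have key := (h x hb 0 hx).2
    rwa [matMul_single] at key
  tfae_have 7 → 5 := by
    intro h E hE
    have key := (h _ (bdd_indicator_one E) (hI.idealLim_indicator hE)).2
    rw [indicator_comp_perm_symm] at key
    exact hJ.mem_of_idealLim_indicator_zero key
  tfae_finish
end
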